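/- arXiv:1412.2087 — 2 statements merged into one kernel-verified Lean document; each statement's English description precedes it below -/
import Mathlib

section
/- Let K be a kernel on ℝ² and let Φ be a point process on ℝ² that satisfies the DPP Laplace identity with kernel K on compactly supported functions, and whose intensity measure is K(x,x)dx, i.e. E[∫ g dΦ] = ∫_{ℝ²} K(x,x) g(x) dx for every nonnegative measurable g. Then for every nonnegative measurable function f : ℝ² → [0,∞) satisfying conditions (a)–(c) with respect to K, one has E[exp(−∫_{ℝ²} f dΦ)] = Σ_{n=0}^∞ ((−1)^n/n!) ∫_{(ℝ²)^n} det(K(x_i,x_j))_{1≤i,j≤n} Π_{i=1}^n (1−e^{−f(x_i)}) dx_1⋯dx_n. -/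
open MeasureTheory Measure Metric Filter
open scoped ENNReal NNReal Real Topology BigOperators ComplexOrder

noncomputable section

/-- The Euclidean plane `ℝ²`. -/
abbrev E2 : Type := EuclideanSpace ℝ (Fin 2)

/-- `expNeg a = e^{-a}` for `a ∈ [0,∞]`, with `expNeg ∞ = 0`. -/
def expNeg (a : ℝ≥0∞) : ℝ := if a = ∞ then 0 else Real.exp (-a.toReal)

/-- A kernel on `ℝ²`: continuous, Hermitian, locally square integrable, positive
semidefinite. -/
structure IsKernel (K : E2 → E2 → ℂ) : Prop where
  continuous : Continuous fun p : E2 × E2 => K p.1 p.2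
  hermitian : ∀ x y : E2, K y x = starRingEnd ℂ (K x y)
  locSqInt : ∀ s : Set (E2 × E2), IsCompact s →
    IntegrableOn (fun p : E2 × E2 => ‖K p.1 p.2‖ ^ 2) s
  posSemidef : ∀ (n : ℕ) (x : Fin n → E2),
    (Matrix.of fun i j : Fin n => K (x i) (x j)).PosSemidef

/-- Conditions (a)–(c) on a nonnegative function `f` with respect to a kernel `K`:
(a) `f(x) → 0` as `‖x‖ → ∞`; (b) `∫_{ℝ²∖B(0,r)} K(x,x) f(x) dx → 0` as `r → ∞`;
(c) `∫_{ℝ²} K(x,x)(1-e^{-f(x)}) dx < ∞`. -/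
structure SatConds (K : E2 → E2 → ℂ) (f : E2 → ℝ≥0∞) : Prop where
  tendsto_zero : Tendsto f (Bornology.cobounded E2) (nhds 0)
  tail_tendsto_zero : Tendsto
    (fun r : ℝ => ∫⁻ x in (closedBall (0 : E2) r)ᶜ, ENNReal.ofReal (K x x).re * f x)
    atTop (nhds 0)
  finite_integral : ∫⁻ x : E2, ENNReal.ofReal ((K x x).re * (1 - expNeg (f x))) < ∞

/-- The `n`-th term of the Fredholm-type determinantal series
`((-1)^n/n!) ∫_{(ℝ²)^n} det(K(x_i,x_j)) ∏ g(x_i) dx`. -/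
def dppTerm (K : E2 → E2 → ℂ) (g : E2 → ℝ) (n : ℕ) : ℂ :=
  ((-1 : ℂ) ^ n / n.factorial) *
    ∫ x : Fin n → E2,
      (Matrix.of fun i j : Fin n => K (x i) (x j)).det * ∏ i : Fin n, (g (x i) : ℂ)

/-- The point process `Φ` (on a probability space `(Ω, μ)`) satisfies the DPP Laplace
identity with kernel `K` on compactly supported functions. -/
def DPPLaplaceOnCompact {Ω : Type} [MeasurableSpace Ω] (μ : Measure Ω)
    (Φ : Ω → Measure E2) (K : E2 → E2 → ℂ) : Prop :=
  ∀ f : E2 → ℝ≥0∞, Measurable f → (∃ s : Set E2, IsCompact s ∧ ∀ x ∉ s, f x = 0) →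
    ((∫ ω, expNeg (∫⁻ x, f x ∂(Φ ω)) ∂μ : ℝ) : ℂ) =
      ∑' n : ℕ, dppTerm K (fun x => 1 - expNeg (f x)) n

lemma det_le_one_of_diag_one {n : ℕ} (A : Matrix (Fin n) (Fin n) ℂ) (hA : A.PosSemidef)
    (h1 : ∀ i, A i i = 1) : ‖A.det‖ ≤ 1 := by
  have htr : ∑ i, hA.1.eigenvalues i = n := by
    have h := hA.1.trace_eq_sum_eigenvalues
    have h2 : A.trace = (n : ℂ) := by simp [Matrix.trace, h1]
    rw [h2] at h
    have h3 : ((∑ i, hA.1.eigenvalues i : ℝ) : ℂ) = ((n : ℝ) : ℂ) := by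
      push_cast; exact h.symm
    exact_mod_cast h3
  have hdet : A.det = ((∏ i, hA.1.eigenvalues i : ℝ) : ℂ) := by
    rw [hA.1.det_eq_prod_eigenvalues]; push_cast; rfl
  have hnn : 0 ≤ ∏ i, hA.1.eigenvalues i :=
    Finset.prod_nonneg fun i _ => hA.eigenvalues_nonneg i
  rw [hdet, Complex.norm_real, Real.norm_of_nonneg hnn]
  calc ∏ i, hA.1.eigenvalues i ≤ ∏ i, Real.exp (hA.1.eigenvalues i - 1) := by
        apply Finset.prod_le_prod
        · intro i _; exact hA.eigenvalues_nonneg i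
        · intro i _
          have := Real.add_one_le_exp (hA.1.eigenvalues i - 1)
          linarith
    _ = 1 := by
        rw [← Real.exp_sum, Finset.sum_sub_distrib, htr]; simp

lemma hadamard_psd {n : ℕ} (A : Matrix (Fin n) (Fin n) ℂ) (hA : A.PosSemidef) :
    ‖A.det‖ ≤ ∏ i, (A i i).re := by
  have hd : ∀ i, 0 ≤ (A i i).re ∧ A i i = ((A i i).re : ℂ) := by
    intro i
    have h := hA.diag_nonneg (i := i)
    rw [Complex.le_def] at h
    refine ⟨by simpa using h.1, ?_⟩
    apply Complex.ext
    · simp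
    · simpa using h.2.symm
  have hprod : 0 ≤ ∏ i, (A i i).re := Finset.prod_nonneg fun i _ => (hd i).1
  by_cases hz : ∃ i, (A i i).re = 0
  · obtain ⟨i, hi⟩ := hz
    have h0 : A.det = 0 := by
      have hAi : A i i = 0 := by rw [(hd i).2, hi]; simp
      have hq : star (Pi.single i (1:ℂ)) ⬝ᵥ (A.mulVec (Pi.single i 1)) = 0 := by
        simp [Pi.star_single, hAi]
      have hv := (hA.dotProduct_mulVec_zero_iff (Pi.single i 1)).1 hq
      apply Matrix.exists_mulVec_eq_zero_iff.1
      exact ⟨Pi.single i 1, by simp, hv⟩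
    rw [h0]; simpa using hprod
  · push Not at hz
    have hpos : ∀ i, 0 < (A i i).re := fun i => lt_of_le_of_ne (hd i).1 (Ne.symm (hz i))
    set D : Matrix (Fin n) (Fin n) ℂ :=
      Matrix.diagonal fun i => (((Real.sqrt (A i i).re)⁻¹ : ℝ) : ℂ) with hD
    have hDH : D.conjTranspose = D := by
      rw [hD, Matrix.diagonal_conjTranspose]
      congr 1; ext i; simp
    have hB := hA.mul_mul_conjTranspose_same D
    rw [hDH] at hB
    have hB1 := det_le_one_of_diag_one _ hB (by
      intro i
      rw [hD, Matrix.mul_diagonal, Matrix.diagonal_mul]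
      have hs := Real.mul_self_sqrt (hd i).1
      have hs0 := (Real.sqrt_pos.2 (hpos i)).ne'
      have key : (Real.sqrt (A i i).re)⁻¹ * (A i i).re * (Real.sqrt (A i i).re)⁻¹ = 1 := by
        nth_rewrite 2 [← hs]
        field_simp
      calc _ = (((Real.sqrt (A i i).re)⁻¹ : ℝ) : ℂ) * ((A i i).re : ℂ) *
            (((Real.sqrt (A i i).re)⁻¹ : ℝ) : ℂ) := by rw [← (hd i).2]
        _ = 1 := by exact_mod_cast key)
    rw [Matrix.det_mul, Matrix.det_mul, norm_mul, norm_mul, hD, Matrix.det_diagonal,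
      ← Complex.ofReal_prod, Complex.norm_real, Finset.prod_inv_distrib] at hB1
    have hP : ∏ i, (A i i).re = (∏ i, Real.sqrt (A i i).re) * ∏ i, Real.sqrt (A i i).re := by
      rw [← Finset.prod_mul_distrib]
      exact Finset.prod_congr rfl fun i _ => (Real.mul_self_sqrt (hd i).1).symm
    have hs : 0 < ∏ i, Real.sqrt (A i i).re :=
      Finset.prod_pos fun i _ => Real.sqrt_pos.2 (hpos i)
    rw [Real.norm_of_nonneg (inv_nonneg.2 hs.le)] at hB1
    rw [hP]
    field_simp at hB1
    nlinarith

lemma expNeg_eq (a : ℝ≥0∞) : expNeg a = (EReal.exp (-(a : EReal))).toReal := by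
  unfold expNeg
  split_ifs with h
  · simp [h]
  · lift a to ℝ≥0 using h
    have : -(((a : ℝ≥0∞)) : EReal) = ((-(a : ℝ) : ℝ) : EReal) := by
      rw [EReal.coe_neg]; rfl
    rw [this, EReal.exp_coe, ENNReal.toReal_ofReal (Real.exp_pos _).le]
    simp

lemma expNeg_nonneg (a : ℝ≥0∞) : 0 ≤ expNeg a := by
  unfold expNeg
  split_ifs
  · exact le_rfl
  · exact (Real.exp_pos _).le

lemma expNeg_le_one (a : ℝ≥0∞) : expNeg a ≤ 1 := by
  unfold expNeg
  split_ifs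
  · exact zero_le_one
  · exact Real.exp_le_one_iff.2 (by simp)

lemma continuous_expNeg : Continuous expNeg := by
  have h : expNeg = fun a : ℝ≥0∞ => (EReal.exp (-(a : EReal))).toReal := funext expNeg_eq
  rw [h]
  have hc : Continuous fun a : ℝ≥0∞ => EReal.exp (-(a : EReal)) :=
    ENNReal.continuous_exp.comp (continuous_neg.comp continuous_coe_ennreal_ereal)
  rw [continuous_iff_continuousAt]
  intro a
  refine (ENNReal.continuousAt_toReal ?_).comp (f := fun a : ℝ≥0∞ => EReal.exp (-(a : EReal)))
    hc.continuousAt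
  intro ht
  rw [EReal.exp_eq_top_iff] at ht
  simp at ht

/-- If a point process `Φ` satisfies the DPP Laplace identity with
kernel `K` on compactly supported functions and has intensity measure `K(x,x)dx`,
then the DPP Laplace identity extends to every nonnegative measurable `f`
satisfying conditions (a)–(c) with respect to `K`. -/
theorem stmt_0 {Ω : Type} [MeasurableSpace Ω] (μ : Measure Ω) [IsProbabilityMeasure μ]
    (K : E2 → E2 → ℂ) (hK : IsKernel K)
    (Φ : Ω → Measure E2)
    (hΦmeas : ∀ g : E2 → ℝ≥0∞, Measurable g → Measurable fun ω => ∫⁻ x, g x ∂(Φ ω))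
    (hΦlocfin : ∀ ω, ∀ s : Set E2, IsCompact s → Φ ω s < ∞)
    (hintensity : ∀ g : E2 → ℝ≥0∞, Measurable g →
      ∫⁻ ω, (∫⁻ x, g x ∂(Φ ω)) ∂μ = ∫⁻ x : E2, ENNReal.ofReal (K x x).re * g x)
    (hLaplace : DPPLaplaceOnCompact μ Φ K)
    (f : E2 → ℝ≥0∞) (hf : Measurable f) (hconds : SatConds K f) :
    ((∫ ω, expNeg (∫⁻ x, f x ∂(Φ ω)) ∂μ : ℝ) : ℂ) =
      ∑' n : ℕ, dppTerm K (fun x => 1 - expNeg (f x)) n := by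
  set g : E2 → ℝ := fun x => 1 - expNeg (f x) with hg
  have hg0 : ∀ x, 0 ≤ g x := fun x => sub_nonneg.2 (expNeg_le_one _)
  have hgm : Measurable g := measurable_const.sub (continuous_expNeg.measurable.comp hf)
  have hdiag : ∀ x, 0 ≤ (K x x).re := by
    intro x
    have h := (hK.posSemidef 1 (fun _ => x)).diag_nonneg (i := 0)
    rw [Complex.le_def] at h
    simpa using h.1
  have hdm : Continuous fun x => (K x x).re :=
    Complex.continuous_re.comp (hK.continuous.comp (continuous_id.prodMk continuous_id))
  set G : E2 → ℝ := fun x => (K x x).re * g x with hG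
  have hGm : Measurable G := hdm.measurable.mul hgm
  have hG0 : ∀ x, 0 ≤ G x := fun x => mul_nonneg (hdiag x) (hg0 x)
  have hGi : Integrable G := by
    refine ⟨hGm.aestronglyMeasurable, ?_⟩
    rw [hasFiniteIntegral_iff_ofReal (Eventually.of_forall hG0)]
    exact hconds.finite_integral
  -- truncations
  set fN : ℕ → E2 → ℝ≥0∞ := fun N => (closedBall (0 : E2) N).indicator f with hfN
  have hfNm : ∀ N, Measurable (fN N) := fun N => hf.indicator isClosed_closedBall.measurableSet
  have hfNle : ∀ N x, fN N x ≤ f x := fun N x => Set.indicator_le_self _ _ _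
  have hfNev : ∀ x, ∀ᶠ N in atTop, fN N x = f x := by
    intro x
    obtain ⟨M, hM⟩ := exists_nat_ge ‖x‖
    filter_upwards [eventually_ge_atTop M] with N hN
    apply Set.indicator_of_mem
    rw [mem_closedBall_zero_iff]
    exact hM.trans (by exact_mod_cast hN)
  have hfNmono : Monotone fN := by
    intro M N h
    exact Set.indicator_le_indicator_of_subset
      (closedBall_subset_closedBall (by exact_mod_cast h)) (fun _ => zero_le)
  have hLap := fun N => hLaplace (fN N) (hfNm N)
    ⟨closedBall 0 N, isCompact_closedBall _ _, fun x hx => Set.indicator_of_notMem hx _⟩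
  have hL : Tendsto (fun N => ((∫ ω, expNeg (∫⁻ x, fN N x ∂(Φ ω)) ∂μ : ℝ) : ℂ)) atTop
      (𝓝 ((∫ ω, expNeg (∫⁻ x, f x ∂(Φ ω)) ∂μ : ℝ) : ℂ)) := by
    refine (Complex.continuous_ofReal.tendsto _).comp ?_
    refine tendsto_integral_of_dominated_convergence (fun _ => (1 : ℝ)) ?_
      (integrable_const _) ?_ ?_
    · intro N
      exact (continuous_expNeg.measurable.comp (hΦmeas _ (hfNm N))).aestronglyMeasurable
    · intro N
      refine Eventually.of_forall fun ω => ?_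
      rw [Real.norm_of_nonneg (expNeg_nonneg _)]
      exact expNeg_le_one _
    · refine Eventually.of_forall fun ω => ?_
      refine (continuous_expNeg.tendsto _).comp ?_
      exact lintegral_tendsto_of_tendsto_of_monotone (fun N => (hfNm N).aemeasurable)
        (Eventually.of_forall fun x M N h => hfNmono h x)
        (Eventually.of_forall fun x => tendsto_const_nhds.congr'
          ((hfNev x).mono fun N h => h.symm))
  have hgN : ∀ N x, 0 ≤ 1 - expNeg (fN N x) ∧ 1 - expNeg (fN N x) ≤ g x := by
    intro N x
    refine ⟨sub_nonneg.2 (expNeg_le_one _), ?_⟩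
    by_cases hx : x ∈ closedBall (0 : E2) N
    · simp [hfN, hg, Set.indicator_of_mem hx]
    · have : expNeg 0 = 1 := by simp [expNeg]
      simp only [hfN, Set.indicator_of_notMem hx, this, sub_self]
      exact hg0 x
  have hbound : ∀ (n : ℕ) (N : ℕ) (x : Fin n → E2),
      ‖(Matrix.of fun i j : Fin n => K (x i) (x j)).det *
        ∏ i : Fin n, ((1 - expNeg (fN N (x i)) : ℝ) : ℂ)‖ ≤ ∏ i, G (x i) := by
    intro n N x
    rw [norm_mul, ← Complex.ofReal_prod, Complex.norm_real, Real.norm_of_nonneg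
      (Finset.prod_nonneg fun i _ => (hgN N (x i)).1), hG, Finset.prod_mul_distrib]
    refine mul_le_mul (hadamard_psd _ (hK.posSemidef n x)) ?_
      (Finset.prod_nonneg fun i _ => (hgN N (x i)).1)
      (Finset.prod_nonneg fun i _ => hdiag (x i))
    exact Finset.prod_le_prod (fun i _ => (hgN N (x i)).1) fun i _ => (hgN N (x i)).2
  have hPi : ∀ n : ℕ, Integrable (fun x : Fin n → E2 => ∏ i, G (x i)) := fun n =>
    Integrable.fintype_prod (f := fun _ : Fin n => G) (fun _ => hGi)
  have hR : Tendsto (fun N => ∑' n : ℕ, dppTerm K (fun x => 1 - expNeg (fN N x)) n) atTop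
      (𝓝 (∑' n : ℕ, dppTerm K g n)) := by
    refine tendsto_tsum_of_dominated_convergence
      (bound := fun n : ℕ => (∫ x, G x) ^ n / n.factorial)
      (Real.summable_pow_div_factorial _) ?_ ?_
    · intro n
      unfold dppTerm
      refine Tendsto.const_mul _ ?_
      refine tendsto_integral_of_dominated_convergence (fun x => ∏ i, G (x i)) ?_ (hPi n) ?_ ?_
      · intro N
        apply AEStronglyMeasurable.mul
        · apply Continuous.aestronglyMeasurable
          apply Continuous.matrix_det
          apply continuous_matrix
          intro i j
          exact hK.continuous.comp (f := fun x : Fin n → E2 => (x i, x j))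
            ((continuous_apply i).prodMk (continuous_apply j))
        · apply Measurable.aestronglyMeasurable
          apply Finset.measurable_prod
          intro i _
          exact Complex.measurable_ofReal.comp (measurable_const.sub
            (continuous_expNeg.measurable.comp ((hfNm N).comp (measurable_pi_apply i))))
      · exact fun N => Eventually.of_forall fun x => hbound n N x
      · refine Eventually.of_forall fun x => ?_
        refine Tendsto.const_mul _ ?_
        apply tendsto_finsetProd
        intro i _
        refine tendsto_const_nhds.congr' ((hfNev (x i)).mono fun N h => ?_)
        simp only [hg, h]
    · refine Eventually.of_forall fun N n => ?_
      unfold dppTerm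
      rw [norm_mul, norm_div, norm_pow, norm_neg, norm_one, one_pow, Complex.norm_natCast,
        div_eq_inv_mul, mul_one, div_eq_inv_mul]
      refine mul_le_mul_of_nonneg_left ?_ (by positivity)
      refine (norm_integral_le_of_norm_le (hPi n) (Eventually.of_forall (hbound n N))).trans ?_
      rw [integral_fintype_prod_volume_eq_pow]
      simp
  refine tendsto_nhds_unique hL (hR.congr fun N => (hLap N).symm)
end
end

section
/- Let K be a stationary and isotropic kernel on ℝ², i.e. K(x,y) = K₀(x−y) where K₀ : ℝ² → ℂ depends only on the norm of its argument, with K₀ continuous and K₀(0) = λ > 0. Define F(r) = Σ_{n=1}^∞ ((−1)^{n−1}/n!) ∫_{(B(0,r))^n} det(K(x_i,x_j))_{1≤i,j≤n} dx_1⋯dx_n for r ≥ 0 (the empty space function of the DPP with kernel K). Then F is differentiable on (0,∞) and for all r > 0, F'(r) = 2πr · Σ_{n=0}^∞ ((−1)^n/n!) ∫_{(B(0,r))^n} det(K(x_i,x_j))_{0≤i,j≤n} dx_1⋯dx_n, where in the (n+1)×(n+1) determinant the distinguished point is x₀ = (r,0). -/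
open MeasureTheory Measure Metric Filter
open scoped ENNReal NNReal Real Topology BigOperators ComplexOrder

noncomputable section

/-- The point `(a, b)` of `ℝ²`. -/
def pt (a b : ℝ) : E2 := (EuclideanSpace.equiv (Fin 2) ℝ).symm ![a, b]

/-- `∫_{(B(0,r))^n} det(K(x_i,x_j))_{1≤i,j≤n} dx_1⋯dx_n`. -/
def ballDetInt (K : E2 → E2 → ℂ) (r : ℝ) (n : ℕ) : ℂ :=
  ∫ x in Set.univ.pi fun _ : Fin n => closedBall (0 : E2) r,
    (Matrix.of fun i j : Fin n => K (x i) (x j)).det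

/-- `∫_{(B(0,r))^n} det(K(x_i,x_j))_{0≤i,j≤n} dx_1⋯dx_n` with distinguished point `x₀`. -/
def ballDetIntCons (K : E2 → E2 → ℂ) (x₀ : E2) (r : ℝ) (n : ℕ) : ℂ :=
  ∫ x in Set.univ.pi fun _ : Fin n => closedBall (0 : E2) r,
    (Matrix.of fun i j : Fin (n + 1) =>
      K ((Fin.cons x₀ x : Fin (n + 1) → E2) i) ((Fin.cons x₀ x : Fin (n + 1) → E2) j)).det

/-- The empty space function
`F(r) = Σ_{n≥1} ((-1)^{n-1}/n!) ∫_{(B(0,r))^n} det(K(x_i,x_j)) dx` of the DPP with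
kernel `K`. -/
def emptySpaceF (K : E2 → E2 → ℂ) (r : ℝ) : ℝ :=
  ∑' n : ℕ, ((-1 : ℝ) ^ n / (n + 1).factorial) * (ballDetInt K r (n + 1)).re

/-- determinant function -/
def dd (K₀ : E2 → ℂ) (n : ℕ) (x : Fin n → E2) : ℂ :=
  (Matrix.of fun i j : Fin n => K₀ (x i - x j)).det

/-- cube of balls -/
def BB (r : ℝ) (n : ℕ) : Set (Fin n → E2) := Set.univ.pi fun _ : Fin n => closedBall (0 : E2) r

/-- the inner integral -/
def HH (K₀ : E2 → ℂ) (n : ℕ) (r : ℝ) (x₀ : E2) : ℂ :=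
  ∫ x in BB r n, dd K₀ (n + 1) (Fin.cons x₀ x : Fin (n + 1) → E2)

lemma BB_compact (r : ℝ) (n : ℕ) : IsCompact (BB r n) :=
  isCompact_univ_pi fun _ => isCompact_closedBall _ _

lemma dd_continuous {K₀ : E2 → ℂ} (h : Continuous K₀) (n : ℕ) : Continuous (dd K₀ n) := by
  unfold dd
  apply Continuous.matrix_det
  apply continuous_matrix
  intro i j
  simp only [Matrix.of_apply]
  fun_prop

lemma dd_bound {K₀ : E2 → ℂ} {lam : ℝ} (hlam : 0 < lam) (h0 : K₀ 0 = (lam : ℂ))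
    (hker : IsKernel fun x y => K₀ (x - y)) (n : ℕ) (x : Fin n → E2) :
    ‖dd K₀ n x‖ ≤ lam ^ n := by
  rcases Nat.eq_zero_or_pos n with rfl | hn
  · simp [dd]
  have hp := hker.posSemidef n x
  have hH := hp.isHermitian
  have hnn : ∀ i, 0 ≤ hH.eigenvalues i := hp.eigenvalues_nonneg
  have htr : ∑ i, hH.eigenvalues i = n * lam := by
    have := hH.trace_eq_sum_eigenvalues
    have h2 : (Matrix.of fun i j : Fin n => K₀ (x i - x j)).trace = ((n * lam : ℝ) : ℂ) := by
      simp [Matrix.trace, h0]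
    rw [h2] at this
    have h3 := congrArg Complex.re this
    simpa using h3.symm
  have hdet : ‖dd K₀ n x‖ = ∏ i, hH.eigenvalues i := by
    unfold dd
    rw [hH.det_eq_prod_eigenvalues, norm_prod]
    refine Finset.prod_congr rfl fun i _ => ?_
    simpa using hnn i
  rw [hdet]
  have hn' : (0 : ℝ) < n := by exact_mod_cast hn
  have := Real.geom_mean_le_arith_mean Finset.univ (fun _ => (1:ℝ)) hH.eigenvalues
    (by simp) (by simpa using hn) (fun i _ => hnn i)
  simp only [Real.rpow_one, one_mul, htr, Finset.sum_const, Finset.card_univ, Fintype.card_fin,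
    nsmul_eq_mul, mul_one] at this
  rw [mul_div_cancel_left₀ _ hn'.ne'] at this
  have hP : 0 ≤ ∏ i, hH.eigenvalues i := Finset.prod_nonneg fun i _ => hnn i
  calc ∏ i, hH.eigenvalues i = ((∏ i, hH.eigenvalues i) ^ ((n:ℝ)⁻¹)) ^ n :=
        (Real.rpow_inv_natCast_pow hP hn.ne').symm
    _ ≤ lam ^ n := pow_le_pow_left₀ (Real.rpow_nonneg hP _) this n

lemma dd_insertNth (K₀ : E2 → ℂ) (n : ℕ) (i : Fin (n + 1)) (x : E2) (y : Fin n → E2) :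
    dd K₀ (n + 1) (i.insertNth (α := fun _ => E2) x y) = dd K₀ (n + 1) (Fin.cons x y : Fin (n + 1) → E2) := by
  let σ : Fin (n + 1) ≃ Fin (n + 1) := (finSuccEquiv' 0).trans (finSuccEquiv' i).symm
  have h : ∀ k, (i.insertNth (α := fun _ => E2) x y) (σ k) = (Fin.cons x y : Fin (n + 1) → E2) k := by
    intro k
    refine Fin.cases ?_ (fun k => ?_) k
    · simp [σ]
    · have : finSuccEquiv' (0 : Fin (n+1)) k.succ = some k := by
        simp
      simp [σ, this]
  unfold dd
  rw [← Matrix.det_submatrix_equiv_self σ]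
  congr 1
  ext a b
  simp only [Matrix.submatrix_apply, Matrix.of_apply, h]

lemma vol_BB (r : ℝ) (n : ℕ) :
    volume.real (BB r n) = (volume.real (closedBall (0 : E2) r)) ^ n := by
  simp [BB, measureReal_def, volume_pi_pi]

lemma norm_ballDetInt_le {K₀ : E2 → ℂ} {lam : ℝ} (hlam : 0 < lam) (h0 : K₀ 0 = (lam : ℂ))
    (hker : IsKernel fun x y => K₀ (x - y)) (n : ℕ) (r : ℝ) :
    ‖∫ x in BB r n, dd K₀ n x‖ ≤ lam ^ n * (volume.real (closedBall (0 : E2) r)) ^ n := by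
  rw [← vol_BB]
  exact norm_setIntegral_le_of_norm_le_const (BB_compact r n).measure_lt_top
    fun x _ => dd_bound hlam h0 hker n x

lemma norm_HH_le {K₀ : E2 → ℂ} {lam : ℝ} (hlam : 0 < lam) (h0 : K₀ 0 = (lam : ℂ))
    (hker : IsKernel fun x y => K₀ (x - y)) (n : ℕ) (r : ℝ) (x₀ : E2) :
    ‖HH K₀ n r x₀‖ ≤ lam ^ (n + 1) * (volume.real (closedBall (0 : E2) r)) ^ n := by
  rw [← vol_BB]
  exact norm_setIntegral_le_of_norm_le_const (BB_compact r n).measure_lt_top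
    fun x _ => dd_bound hlam h0 hker (n + 1) _

lemma HH_iso {K₀ : E2 → ℂ} (hiso : ∀ x y : E2, ‖x‖ = ‖y‖ → K₀ x = K₀ y)
    (n : ℕ) (r : ℝ) (x y : E2) (h : ‖x‖ = ‖y‖) : HH K₀ n r x = HH K₀ n r y := by
  let R := (Submodule.reflection (Submodule.span ℝ {x - y})ᗮ)
  have hR : R x = y := Submodule.reflection_sub h
  let e : (Fin n → E2) ≃ᵐ (Fin n → E2) :=
    MeasurableEquiv.piCongrRight fun _ => R.toHomeomorph.toMeasurableEquiv
  have he : MeasurePreserving e volume volume :=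
    volume_preserving_pi (fun _ => R.measurePreserving)
  have hpre : e ⁻¹' (BB r n) = BB r n := by
    ext z
    simp [BB, Set.mem_pi, e, MeasurableEquiv.piCongrRight]
  symm
  unfold HH
  rw [← he.setIntegral_preimage_emb e.measurableEmbedding _ (BB r n), hpre]
  congr 1
  ext z
  unfold dd
  congr 1
  ext i j
  simp only [Matrix.of_apply]
  apply hiso
  have key : ∀ i, (Fin.cons y (e z) : Fin (n+1) → E2) i = R ((Fin.cons x z : Fin (n+1) → E2) i) := by
    intro i
    refine Fin.cases ?_ (fun k => ?_) i
    · simp [hR]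
    · rfl
  rw [key, key, ← map_sub, R.norm_map]

lemma norm_pt (s : ℝ) (hs : 0 ≤ s) : ‖pt s 0‖ = s := by
  simp [pt, EuclideanSpace.norm_eq, Fin.sum_univ_two, Real.sqrt_sq hs]

open scoped Pointwise in
lemma HH_cont {K₀ : E2 → ℂ} (h : Continuous K₀) (n : ℕ) :
    ∃ g : ℝ → ℂ, Continuous g ∧ ∀ s, 0 < s → HH K₀ n s (pt s 0) = g s := by
  refine ⟨fun s => (s ^ Module.finrank ℝ (Fin n → E2)) •
    ∫ x in BB 1 n, dd K₀ (n + 1) (Fin.cons (pt s 0) (s • x) : Fin (n + 1) → E2), ?_, ?_⟩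
  · refine (continuous_pow _).smul ?_
    refine continuous_parametric_integral_of_continuous ?_ (BB_compact 1 n)
    refine (dd_continuous h (n+1)).comp ?_
    refine continuous_pi fun i => ?_
    refine Fin.cases ?_ (fun k => ?_) i
    · simp only [Fin.cons_zero]
      unfold pt
      refine (EuclideanSpace.equiv (Fin 2) ℝ).symm.continuous.comp ?_
      refine continuous_pi fun j => ?_
      fin_cases j
      · exact continuous_fst
      · exact continuous_const
    · simp only [Fin.cons_succ]
      fun_prop
  · intro s hs
    have := setIntegral_comp_smul_of_pos (volume : Measure (Fin n → E2))
      (fun x => dd K₀ (n + 1) (Fin.cons (pt s 0) x : Fin (n + 1) → E2)) (BB 1 n) hs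
    have hB : s • BB 1 n = BB s n := by
      unfold BB
      have h1 := closedBall_pi (0 : Fin n → E2) (zero_le_one (α := ℝ))
      have h2 := closedBall_pi (0 : Fin n → E2) hs.le
      simp only [Pi.zero_apply] at h1 h2
      rw [← h1, ← h2, _root_.smul_closedBall _ _ zero_le_one]
      simp [abs_of_pos hs]
    rw [hB] at this
    simp only [this]
    rw [smul_smul, mul_inv_cancel₀ (by positivity), one_smul]
    rfl

/-- the region where coordinate `i` has maximal norm -/
def AA (r : ℝ) (n : ℕ) (i : Fin (n + 1)) : Set (Fin (n + 1) → E2) :=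
  {x | ‖x i‖ ≤ r ∧ ∀ j : Fin n, ‖x (i.succAbove j)‖ ≤ ‖x i‖}

lemma AA_closed (r : ℝ) (n : ℕ) (i : Fin (n + 1)) : IsClosed (AA r n i) := by
  have h1 : IsClosed {x : Fin (n + 1) → E2 | ‖x i‖ ≤ r} := isClosed_le (by fun_prop) (by fun_prop)
  refine h1.inter ?_
  change IsClosed {x : Fin (n + 1) → E2 | ∀ j : Fin n, ‖x (i.succAbove j)‖ ≤ ‖x i‖}
  simp only [Set.setOf_forall]
  exact isClosed_iInter fun j => isClosed_le (by fun_prop) (by fun_prop)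

lemma AA_max {r : ℝ} {n : ℕ} {i : Fin (n + 1)} {x : Fin (n + 1) → E2} (hx : x ∈ AA r n i)
    (k : Fin (n + 1)) : ‖x k‖ ≤ ‖x i‖ := by
  rcases eq_or_ne k i with rfl | h
  · exact le_rfl
  · obtain ⟨j, rfl⟩ := Fin.exists_succAbove_eq h
    exact hx.2 j

lemma AA_union (r : ℝ) (n : ℕ) : ⋃ i, AA r n i = BB r (n + 1) := by
  ext x
  simp only [Set.mem_iUnion, BB, Set.mem_pi, Set.mem_univ, true_imp_iff, mem_closedBall,
    dist_zero_right]
  constructor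
  · rintro ⟨i, hi⟩ k
    exact (AA_max hi k).trans hi.1
  · intro h
    obtain ⟨i, hi⟩ := Finite.exists_max fun k => ‖x k‖
    exact ⟨i, h i, fun j => hi _⟩

lemma tie_null (n : ℕ) (i : Fin (n + 1)) (j : Fin n) :
    volume {x : Fin (n + 1) → E2 | ‖x i‖ = ‖x (i.succAbove j)‖} = 0 := by
  have hmp := volume_preserving_piFinSuccAbove (fun _ : Fin (n + 1) => E2) i
  have hm : MeasurableSet {p : E2 × (Fin n → E2) | ‖p.1‖ = ‖p.2 j‖} :=
    (isClosed_eq (by fun_prop) (by fun_prop)).measurableSet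
  have : {x : Fin (n + 1) → E2 | ‖x i‖ = ‖x (i.succAbove j)‖} =
    (MeasurableEquiv.piFinSuccAbove (fun _ : Fin (n + 1) => E2) i) ⁻¹'
      {p : E2 × (Fin n → E2) | ‖p.1‖ = ‖p.2 j‖} := rfl
  rw [this, hmp.measure_preimage hm.nullMeasurableSet]
  refine (measure_prod_null hm).2 (Eventually.of_forall fun x => ?_)
  have h2 : (Prod.mk x ⁻¹' {p : E2 × (Fin n → E2) | ‖p.1‖ = ‖p.2 j‖}) =
    (Function.eval j) ⁻¹' (sphere (0 : E2) ‖x‖) := by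
    ext y
    simp [eq_comm]
  simp only [Pi.zero_apply]
  rw [h2]
  exact (Measure.quasiMeasurePreserving_eval (fun _ : Fin n => (volume : Measure E2)) j).preimage_null
    (addHaar_sphere _ _ _)

lemma AA_disj (r : ℝ) (n : ℕ) : Pairwise (Function.onFun (AEDisjoint volume) (AA r n)) := by
  intro i k hik
  obtain ⟨j, rfl⟩ := Fin.exists_succAbove_eq hik.symm
  refine measure_mono_null ?_ (tie_null n i j)
  rintro x ⟨h1, h2⟩
  exact le_antisymm (AA_max h2 _) (AA_max h1 _)

lemma int_AA {K₀ : E2 → ℂ} (h : Continuous K₀) (r : ℝ) (n : ℕ) (i : Fin (n + 1)) :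
    ∫ x in AA r n i, dd K₀ (n + 1) x = ∫ x in closedBall (0 : E2) r, HH K₀ n ‖x‖ x := by
  have hmp := (volume_preserving_piFinSuccAbove (fun _ : Fin (n + 1) => E2) i).symm
  have hsub : AA r n i ⊆ BB r (n + 1) := by
    rw [← AA_union]; exact Set.subset_iUnion _ i
  have hint : Integrable ((AA r n i).indicator (dd K₀ (n + 1))) := by
    rw [integrable_indicator_iff (AA_closed r n i).measurableSet]
    exact ((dd_continuous h _).continuousOn.integrableOn_compact (BB_compact r (n+1))).mono_set hsub
  rw [← integral_indicator (AA_closed r n i).measurableSet, ← hmp.integral_comp',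
    ← integral_indicator measurableSet_closedBall]
  have hint2 := (hmp.integrable_comp_emb (MeasurableEquiv.measurableEmbedding _)).2 hint
  refine (integral_prod _ hint2).trans ?_
  congr 1
  ext x
  by_cases hx : x ∈ closedBall (0 : E2) r
  · rw [Set.indicator_of_mem hx]
    unfold HH
    rw [← integral_indicator (BB_compact _ _).isClosed.measurableSet]
    congr 1
    ext y
    have hmem : i.insertNth (α := fun _ => E2) x y ∈ AA r n i ↔ y ∈ BB ‖x‖ n := by
      have : ‖x‖ ≤ r := by simpa using hx
      simp [AA, BB, Set.mem_pi, this]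
    change (AA r n i).indicator (dd K₀ (n + 1)) (i.insertNth (α := fun _ => E2) x y) = _
    by_cases hy : y ∈ BB ‖x‖ n
    · rw [Set.indicator_of_mem hy, Set.indicator_of_mem (hmem.2 hy), dd_insertNth]
    · rw [Set.indicator_of_notMem hy, Set.indicator_of_notMem (fun hh => hy (hmem.1 hh))]
  · rw [Set.indicator_of_notMem hx]
    have : ∀ y, (AA r n i).indicator (dd K₀ (n + 1)) (i.insertNth (α := fun _ => E2) x y) = 0 := by
      intro y
      refine Set.indicator_of_notMem (fun hh => hx ?_) _
      simpa using hh.1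
    refine (integral_congr_ae (Eventually.of_forall this)).trans ?_
    simp

lemma int_BB {K₀ : E2 → ℂ} (h : Continuous K₀)
    (hiso : ∀ x y : E2, ‖x‖ = ‖y‖ → K₀ x = K₀ y) (r : ℝ) (hr : 0 ≤ r) (n : ℕ)
    (g : ℝ → ℂ) (hg : ∀ s, 0 < s → HH K₀ n s (pt s 0) = g s) :
    ∫ x in BB r (n + 1), dd K₀ (n + 1) x =
      ((n : ℂ) + 1) * (2 * π * ∫ s in (0 : ℝ)..r, (s : ℂ) * g s) := by
  have hI : IntegrableOn (dd K₀ (n + 1)) (⋃ i, AA r n i) := by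
    rw [AA_union]
    exact (dd_continuous h _).continuousOn.integrableOn_compact (BB_compact r (n+1))
  rw [← AA_union, integral_iUnion_ae (fun i => (AA_closed r n i).measurableSet.nullMeasurableSet)
    (AA_disj r n) hI]
  simp only [int_AA h, tsum_fintype, Finset.sum_const, Finset.card_univ, Fintype.card_fin,
    nsmul_eq_mul]
  push_cast
  congr 1
  rw [← integral_indicator measurableSet_closedBall]
  have h1 : ∀ x : E2, (closedBall (0 : E2) r).indicator (fun x => HH K₀ n ‖x‖ x) x =
      (Set.Iic r).indicator (fun s => HH K₀ n s (pt s 0)) ‖x‖ := by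
    intro x
    by_cases hx : ‖x‖ ≤ r
    · rw [Set.indicator_of_mem (by simpa using hx), Set.indicator_of_mem (by simpa using hx)]
      exact HH_iso hiso n _ _ _ (norm_pt _ (norm_nonneg x)).symm
    · rw [Set.indicator_of_notMem (by simpa using hx), Set.indicator_of_notMem (by simpa using hx)]
  simp only [h1]
  rw [integral_fun_norm_addHaar volume ((Set.Iic r).indicator (fun s => HH K₀ n s (pt s 0)))]
  have hv : volume.real (ball (0 : E2) 1) = π := by
    simp [measureReal_def, Real.pi_pos.le]
  rw [hv]
  simp only [finrank_euclideanSpace, Fintype.card_fin, nsmul_eq_mul, Complex.real_smul]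
  rw [intervalIntegral.integral_of_le hr]
  have h2 : ∫ y in Set.Ioi (0:ℝ), ((y ^ (2 - 1) : ℝ) : ℂ) *
      (Set.Iic r).indicator (fun s => HH K₀ n s (pt s 0)) y = ∫ s in Set.Ioc 0 r, (s : ℂ) * g s := by
    rw [← integral_indicator measurableSet_Ioi, ← integral_indicator measurableSet_Ioc]
    congr 1
    ext y
    by_cases hy : 0 < y <;> by_cases hy2 : y ≤ r <;> simp [Set.indicator, hy, hy2, hg]
  rw [h2]
  push_cast
  ring

lemma deriv_BB {K₀ : E2 → ℂ} (h : Continuous K₀)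
    (hiso : ∀ x y : E2, ‖x‖ = ‖y‖ → K₀ x = K₀ y) (r : ℝ) (hr : 0 < r) (n : ℕ) :
    HasDerivAt (fun r => (∫ x in BB r (n + 1), dd K₀ (n + 1) x).re)
      (((n : ℝ) + 1) * (2 * π * r * (HH K₀ n r (pt r 0)).re)) r := by
  obtain ⟨g, hgc, hg⟩ := HH_cont h n
  have hc : Continuous fun s : ℝ => (s : ℂ) * g s := by fun_prop
  have h1 : HasDerivAt (fun r : ℝ => ∫ s in (0 : ℝ)..r, (s : ℂ) * g s) ((r : ℂ) * g r) r :=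
    intervalIntegral.integral_hasDerivAt_right (hc.intervalIntegrable _ _)
      (hc.stronglyMeasurableAtFilter _ _) hc.continuousAt
  have h2 := (h1.const_mul (2 * π : ℂ)).const_mul ((n : ℂ) + 1)
  have h3 := Complex.reCLM.hasFDerivAt.comp_hasDerivAt r h2
  have h4 : HasDerivAt (fun r => (∫ x in BB r (n + 1), dd K₀ (n + 1) x).re)
      (Complex.reCLM (((n : ℂ) + 1) * (2 * π * ((r : ℂ) * g r)))) r := by
    refine h3.congr_of_eventuallyEq ?_
    filter_upwards [lt_mem_nhds hr] with s hs
    rw [int_BB h hiso s hs.le n g hg]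
    rfl
  convert h4 using 1
  rw [hg r hr]
  have : ((n : ℂ) + 1) * (2 * π * ((r : ℂ) * g r)) = (((n + 1) * (2 * π * r) : ℝ) : ℂ) * g r := by
    push_cast; ring
  rw [this, Complex.reCLM_apply, Complex.re_ofReal_mul]
  ring

theorem stmt_4 (K₀ : E2 → ℂ) (hK₀cont : Continuous K₀)
    (hiso : ∀ x y : E2, ‖x‖ = ‖y‖ → K₀ x = K₀ y)
    (lam : ℝ) (hlam : 0 < lam) (hK₀0 : K₀ 0 = (lam : ℂ))
    (hker : IsKernel fun x y => K₀ (x - y)) :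
    ∀ r : ℝ, 0 < r →
      HasDerivAt (emptySpaceF fun x y => K₀ (x - y))
        (2 * Real.pi * r *
          ∑' n : ℕ, ((-1 : ℝ) ^ n / n.factorial) *
            (ballDetIntCons (fun x y => K₀ (x - y)) (pt r 0) r n).re) r := by
  intro r hr
  rw [← tsum_mul_left]
  change HasDerivAt (fun z => ∑' n : ℕ, ((-1 : ℝ) ^ n / (n + 1).factorial) *
    (∫ x in BB z (n + 1), dd K₀ (n + 1) x).re) (∑' n : ℕ, 2 * Real.pi * r *
      (((-1 : ℝ) ^ n / n.factorial) * (HH K₀ n r (pt r 0)).re)) r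
  set V : ℝ → ℝ := fun r => volume.real (closedBall (0 : E2) r) with hV
  have hmem : r ∈ Set.Ioo 0 (r + 1) := ⟨hr, by linarith⟩
  refine hasDerivAt_tsum_of_isPreconnected
    (g := fun n z => ((-1 : ℝ) ^ n / (n + 1).factorial) *
      (∫ x in BB z (n + 1), dd K₀ (n + 1) x).re)
    (g' := fun n r => 2 * Real.pi * r *
      (((-1 : ℝ) ^ n / n.factorial) * (HH K₀ n r (pt r 0)).re))
    (u := fun n => 2 * Real.pi * (r + 1) * lam * ((lam * V (r + 1)) ^ n / n.factorial))
    (t := Set.Ioo 0 (r + 1)) (y₀ := r)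
    ((Real.summable_pow_div_factorial _).mul_left _) isOpen_Ioo isPreconnected_Ioo ?_ ?_ hmem ?_ hmem
  · intro n y hy
    refine ((deriv_BB hK₀cont hiso y hy.1 n).const_mul
      ((-1 : ℝ) ^ n / (n + 1).factorial)).congr_deriv ?_
    rw [Nat.factorial_succ]
    push_cast
    have : ((n : ℝ) + 1) ≠ 0 := by positivity
    have : (n.factorial : ℝ) ≠ 0 := by positivity
    field_simp
  · intro n y hy
    have h1 : |(HH K₀ n y (pt y 0)).re| ≤ lam ^ (n + 1) * V (r + 1) ^ n := by
      refine (Complex.abs_re_le_norm _).trans ((norm_HH_le hlam hK₀0 hker n y _).trans ?_)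
      have : volume.real (closedBall (0 : E2) y) ≤ V (r + 1) :=
        measureReal_mono (closedBall_subset_closedBall hy.2.le) (measure_closedBall_lt_top.ne)
      gcongr
    simp only [norm_mul, norm_div, norm_pow, norm_neg, norm_one, one_pow, Real.norm_eq_abs,
      abs_of_pos Real.pi_pos, abs_of_pos hy.1, abs_two, Nat.abs_cast]
    have hy2 := hy.2.le
    have hy1 := hy.1.le
    have hr1 : 0 ≤ r + 1 := by linarith
    calc 2 * π * y * (1 / (n.factorial : ℝ) * |(HH K₀ n y (pt y 0)).re|)
        ≤ 2 * π * (r + 1) * (1 / (n.factorial : ℝ) * (lam ^ (n + 1) * V (r + 1) ^ n)) := by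
          gcongr
      _ = _ := by rw [mul_pow, pow_succ]; ring
  · have hs := (summable_nat_add_iff 1).2 (Real.summable_pow_div_factorial (lam * V r))
    refine Summable.of_norm_bounded hs fun n => ?_
    have h1 : |(∫ x in BB r (n + 1), dd K₀ (n + 1) x).re| ≤ lam ^ (n + 1) * V r ^ (n + 1) :=
      (Complex.abs_re_le_norm _).trans (norm_ballDetInt_le hlam hK₀0 hker (n + 1) r)
    simp only [norm_mul, norm_div, norm_pow, norm_neg, norm_one, one_pow, Real.norm_eq_abs,
      Nat.abs_cast]
    calc 1 / ((n + 1).factorial : ℝ) * |(∫ x in BB r (n + 1), dd K₀ (n + 1) x).re|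
        ≤ 1 / ((n + 1).factorial : ℝ) * (lam ^ (n + 1) * V r ^ (n + 1)) := by gcongr
      _ = _ := by rw [mul_pow]; ring
end
end
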